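/- For all real x with |x| < π/3 and real y, the integral ∫₀^∞ sin(xt) sin(yt) · sinh(πt/6)/sinh(πt/2) dt converges, and (√3/2)·( sinh(x−y)/sinh(3x−3y) − sinh(x+y)/sinh(3x+3y) ) = ∫₀^∞ sin(xt) sin(yt) · sinh(πt/6)/sinh(πt/2) dt, for |x|, |y| < π/3 (with the left side interpreted by continuity at removable singularities). -/

import Mathlib

open Real MeasureTheory

lemma fw_cot (w : ℂ) (hw : w ∈ Complex.integerComplement) :
    Filter.Tendsto (fun n : ℕ => ∑ j ∈ Finset.range n, (1 / (w + j) - 1 / (j + 1 - w)))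
      Filter.atTop (nhds ((π : ℂ) * Complex.cot (π * w))) := by
  have h1 := tendsto_logDeriv_euler_cot_sub hw
  have h2 : Filter.Tendsto (fun n : ℕ => 1 / w - 1 / (w + n)) Filter.atTop (nhds (1 / w - 0)) := by
    apply Filter.Tendsto.sub tendsto_const_nhds
    simp only [one_div]
    apply Filter.Tendsto.comp Filter.tendsto_inv₀_cobounded
    have := tendsto_natCast_atTop_cobounded (α := ℂ)
    rw [← tendsto_norm_atTop_iff_cobounded] at this ⊢
    refine Filter.tendsto_atTop_mono (fun n => ?_)
      (Filter.tendsto_atTop_add_const_right _ (-‖w‖) this)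
    have h := norm_sub_le (w + (n : ℂ)) w
    rw [add_sub_cancel_left] at h
    linarith
  have h3 := h1.add h2
  have e : (π : ℂ) * Complex.cot (π * w) - 1 / w + (1 / w - 0) = π * Complex.cot (π * w) := by ring
  rw [e] at h3
  refine h3.congr fun n => ?_
  induction n with
  | zero => simp
  | succ k ih =>
    rw [Finset.sum_range_succ, Finset.sum_range_succ, ← ih, cotTerm]
    have : (1 : ℂ) / (k + 1 - w) = - (1 / (w - (k + 1))) := by
      rw [← neg_sub, div_neg]
    rw [this]
    push_cast
    ring

lemma fw_int_cos (a s : ℝ) (ha : 0 < a) :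
    IntegrableOn (fun t : ℝ => Real.cos (s * t) * Real.exp (-a * t)) (Set.Ioi 0) ∧
    ∫ t in Set.Ioi (0 : ℝ), Real.cos (s * t) * Real.exp (-a * t) = a / (a ^ 2 + s ^ 2) := by
  have hre : (-a + s * Complex.I : ℂ).re < 0 := by simp [ha]
  have h := integrableOn_exp_mul_complex_Ioi hre 0
  have h2 := integral_exp_mul_complex_Ioi hre 0
  have e : (fun t : ℝ => Real.cos (s * t) * Real.exp (-a * t)) =
      fun t : ℝ => RCLike.re (Complex.exp ((-a + s * Complex.I) * t)) := by
    ext t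
    simp [Complex.exp_re, mul_comm]
  rw [e]
  refine ⟨h.re, ?_⟩
  rw [integral_re h, h2]
  simp [Complex.div_re, Complex.normSq_apply]
  ring

lemma fw_F (s : ℝ) (n : ℕ) :
    IntegrableOn (fun t : ℝ => Real.cos (s * t) *
      (Real.exp (-((n + 1/3) * π) * t) - Real.exp (-((n + 2/3) * π) * t))) (Set.Ioi 0) ∧
    ∫ t in Set.Ioi (0 : ℝ), Real.cos (s * t) *
      (Real.exp (-((n + 1/3) * π) * t) - Real.exp (-((n + 2/3) * π) * t)) =
      ((n + 1/3) * π) / (((n + 1/3) * π) ^ 2 + s ^ 2) -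
      ((n + 2/3) * π) / (((n + 2/3) * π) ^ 2 + s ^ 2) := by
  obtain ⟨h1, h2⟩ := fw_int_cos ((n + 1/3) * π) s (by positivity)
  obtain ⟨h3, h4⟩ := fw_int_cos ((n + 2/3) * π) s (by positivity)
  simp only [mul_sub]
  exact ⟨h1.sub h3, by rw [integral_sub h1 h3, h2, h4]⟩

lemma fw_nonneg (n : ℕ) (t : ℝ) (ht : 0 < t) :
    0 ≤ Real.exp (-((n + 1/3) * π) * t) - Real.exp (-((n + 2/3) * π) * t) := by
  have : -((n + 2/3) * π) * t ≤ -((n + 1/3) * π) * t := by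
    have := mul_pos pi_pos ht
    nlinarith
  linarith [Real.exp_le_exp.2 this]

lemma fw_norm (s : ℝ) : Summable fun n : ℕ => ∫ t in Set.Ioi (0 : ℝ), ‖Real.cos (s * t) *
      (Real.exp (-((n + 1/3) * π) * t) - Real.exp (-((n + 2/3) * π) * t))‖ := by
  have hs : Summable fun n : ℕ => 1 / ((n : ℝ) + 1) ^ 2 := by
    have := (summable_nat_add_iff 1).2 (Real.summable_one_div_nat_pow.2 one_lt_two)
    simpa using this
  refine Summable.of_nonneg_of_le (fun n => integral_nonneg fun t => norm_nonneg _) (fun n => ?_) hs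
  obtain ⟨h1, h2⟩ := fw_F 0 n
  have : ∫ t in Set.Ioi (0 : ℝ), ‖Real.cos (s * t) *
      (Real.exp (-((n + 1/3) * π) * t) - Real.exp (-((n + 2/3) * π) * t))‖ ≤
      ∫ t in Set.Ioi (0 : ℝ), Real.cos (0 * t) *
      (Real.exp (-((n + 1/3) * π) * t) - Real.exp (-((n + 2/3) * π) * t)) := by
    refine setIntegral_mono_on (fw_F s n).1.norm h1 measurableSet_Ioi fun t ht => ?_
    have h0 := fw_nonneg n t ht
    rw [norm_mul, Real.norm_of_nonneg h0]
    gcongr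
    simpa using Real.abs_cos_le_one (s * t)
  refine this.trans ?_
  rw [h2]
  have hp := pi_gt_three
  have e : ((n + 1/3) * π) / (((n + 1/3) * π) ^ 2 + 0 ^ 2) -
      ((n + 2/3) * π) / (((n + 2/3) * π) ^ 2 + 0 ^ 2) = 1 / (3 * π * (n + 1/3) * (n + 2/3)) := by
    field_simp
    ring
  rw [e]
  apply one_div_le_one_div_of_le (by positivity)
  have hn : (0 : ℝ) ≤ n := n.cast_nonneg
  have : 9 * ((n + 1/3) * (n + 2/3)) ≤ 3 * π * (((n : ℝ) + 1/3) * (n + 2/3)) := by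
    gcongr; linarith
  nlinarith

lemma fw_ker (t : ℝ) (ht : 0 < t) :
    HasSum (fun n : ℕ => Real.exp (-((n + 1/3) * π) * t) - Real.exp (-((n + 2/3) * π) * t))
      (Real.sinh (π * t / 6) / Real.sinh (π * t / 2)) := by
  have hq : Real.exp (-(π * t)) < 1 := by
    rw [Real.exp_lt_one_iff]; have := mul_pos pi_pos ht; linarith
  have h := (hasSum_geometric_of_lt_one (Real.exp_nonneg _) hq).mul_left
    (Real.exp (-(π * t) / 3) - Real.exp (-(2 * π * t) / 3))
  have e1 : (fun n : ℕ => Real.exp (-((n + 1/3) * π) * t) - Real.exp (-((n + 2/3) * π) * t)) =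
      fun n : ℕ => (Real.exp (-(π * t) / 3) - Real.exp (-(2 * π * t) / 3)) *
        Real.exp (-(π * t)) ^ n := by
    ext n
    rw [← Real.exp_nat_mul, sub_mul, ← Real.exp_add, ← Real.exp_add]
    ring_nf
  have e2 : Real.sinh (π * t / 6) / Real.sinh (π * t / 2) =
      (Real.exp (-(π * t) / 3) - Real.exp (-(2 * π * t) / 3)) * (1 - Real.exp (-(π * t)))⁻¹ := by
    rw [Real.sinh_eq, Real.sinh_eq, ← div_eq_mul_inv]
    have h3 : Real.exp (-(π * t)) = Real.exp (- (π * t / 2)) * Real.exp (-(π * t / 2)) := by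
      rw [← Real.exp_add]; ring_nf
    have h1 : Real.exp (-(π * t) / 3) = Real.exp (π * t / 6) * Real.exp (-(π * t / 2)) := by
      rw [← Real.exp_add]; ring_nf
    have h2 : Real.exp (-(2 * π * t) / 3) = Real.exp (-(π * t / 6)) * Real.exp (-(π * t / 2)) := by
      rw [← Real.exp_add]; ring_nf
    have h4 : Real.exp (π * t / 2) * Real.exp (-(π * t / 2)) = 1 := by
      rw [← Real.exp_add]; simp
    have h5 : 1 - Real.exp (-(π * t)) =
        (Real.exp (π * t / 2) - Real.exp (-(π * t / 2))) * Real.exp (-(π * t / 2)) := by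
      rw [h3, sub_mul, h4]
    rw [h5, h1, h2, ← sub_mul, mul_div_mul_right _ _ (Real.exp_ne_zero _)]
    rw [div_div_div_cancel_right₀ two_ne_zero]
  rw [e1, e2]
  exact h

lemma fw_mem (s : ℝ) : (1 / 3 + (s / π : ℝ) * Complex.I : ℂ) ∈ Complex.integerComplement := by
  rintro ⟨m, hm⟩
  have := congrArg Complex.re hm
  simp at this
  have h3 : (3 * m : ℝ) = 1 := by rw [this]; norm_num
  have : 3 * m = 1 := by exact_mod_cast h3
  omega

lemma fw_trig (s : ℝ) :
    Complex.cot (π * (1 / 3 + (s / π : ℝ) * Complex.I)) +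
    Complex.cot (π * (1 / 3 + (-s / π : ℝ) * Complex.I)) =
      ((2 * √3 / (2 * Real.cosh (2 * s) + 1) : ℝ) : ℂ) := by
  have n1 := sin_pi_mul_ne_zero (fw_mem s)
  have n2 := sin_pi_mul_ne_zero (fw_mem (-s))
  have hp : (π : ℂ) ≠ 0 := by exact_mod_cast pi_ne_zero
  have e1 : (π * (1 / 3 + (s / π : ℝ) * Complex.I) : ℂ) = (π / 3 : ℝ) + s * Complex.I := by
    push_cast; field_simp
  have e2 : (π * (1 / 3 + (-s / π : ℝ) * Complex.I) : ℂ) = (π / 3 : ℝ) - s * Complex.I := by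
    push_cast; field_simp; ring
  rw [e1] at n1 ⊢
  rw [e2] at n2 ⊢
  rw [Complex.cot, Complex.cot, div_add_div _ _ n1 n2, div_eq_iff (mul_ne_zero n1 n2)]
  rw [Complex.sin_add, Complex.sin_sub, Complex.cos_add, Complex.cos_sub, ← Complex.ofReal_sin,
    ← Complex.ofReal_cos, Real.sin_pi_div_three, Real.cos_pi_div_three, Complex.cos_mul_I,
    Complex.sin_mul_I, ← Complex.ofReal_cosh, ← Complex.ofReal_sinh, Real.cosh_two_mul]
  have hd : 2 * (Real.cosh s ^ 2 + Real.sinh s ^ 2) + 1 ≠ 0 := by positivity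
  have hd' : (2 * ((Real.cosh s : ℂ) ^ 2 + (Real.sinh s : ℂ) ^ 2) + 1 : ℂ) ≠ 0 := by
    exact_mod_cast hd
  have h3 : ((√3 : ℝ) : ℂ) ^ 2 = 3 := by
    rw [← Complex.ofReal_pow, Real.sq_sqrt (by norm_num)]; norm_num
  have hc : (Real.cosh s : ℂ) ^ 2 = (Real.sinh s : ℂ) ^ 2 + 1 := by
    exact_mod_cast Real.cosh_sq s
  push_cast at *
  generalize Complex.cosh (s : ℂ) = C at *
  generalize Complex.sinh (s : ℂ) = S at *
  generalize ((√3 : ℝ) : ℂ) = r at *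
  field_simp
  ring_nf
  have h3' : r ^ 3 = 3 * r := by rw [pow_succ, h3]
  have hc4 : C ^ 4 = (S ^ 2 + 1) ^ 2 := by rw [← hc]; ring
  simp only [h3', hc, hc4, Complex.I_sq]
  ring

lemma fw_term (c s : ℝ) (hc : 0 < c) :
    (((c * π) / ((c * π) ^ 2 + s ^ 2) : ℝ) : ℂ) =
      1 / (2 * π) * (1 / (c + (s / π : ℝ) * Complex.I) + 1 / (c + (-s / π : ℝ) * Complex.I)) := by
  have hp : (π : ℂ) ≠ 0 := by exact_mod_cast pi_ne_zero
  have n1 : (c + (s / π : ℝ) * Complex.I : ℂ) ≠ 0 := by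
    intro h
    have := congrArg Complex.re h
    simp at this
    exact hc.ne' this
  have n2 : (c + (-s / π : ℝ) * Complex.I : ℂ) ≠ 0 := by
    intro h
    have := congrArg Complex.re h
    simp at this
    exact hc.ne' this
  have hd : (c * π) ^ 2 + s ^ 2 ≠ 0 := by positivity
  have hd' : ((c : ℂ) * π) ^ 2 + (s : ℂ) ^ 2 ≠ 0 := by exact_mod_cast hd
  have hm : (c + (s / π : ℝ) * Complex.I : ℂ) * (c + (-s / π : ℝ) * Complex.I) =
      ((c * π) ^ 2 + s ^ 2) / π ^ 2 := by
    push_cast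
    field_simp
    ring_nf
    rw [Complex.I_sq]
    ring
  rw [div_add_div _ _ n1 n2, hm]
  push_cast
  field_simp
  ring

lemma fw_sum (s : ℝ) :
    Filter.Tendsto (fun n : ℕ => ∑ j ∈ Finset.range n,
      (((j + 1/3) * π) / (((j + 1/3) * π) ^ 2 + s ^ 2) -
      ((j + 2/3) * π) / (((j + 2/3) * π) ^ 2 + s ^ 2))) Filter.atTop
      (nhds (√3 / (2 * Real.cosh (2 * s) + 1))) := by
  have h := ((fw_cot _ (fw_mem s)).add (fw_cot _ (fw_mem (-s)))).const_mul (1 / (2 * π) : ℂ)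
  rw [← mul_add, fw_trig] at h
  have hp : (π : ℂ) ≠ 0 := by exact_mod_cast pi_ne_zero
  have e : (1 / (2 * π) * (π * ((2 * √3 / (2 * Real.cosh (2 * s) + 1) : ℝ) : ℂ)) : ℂ) =
      ((√3 / (2 * Real.cosh (2 * s) + 1) : ℝ) : ℂ) := by
    push_cast; field_simp
  rw [e] at h
  rw [← Filter.tendsto_ofReal_iff]
  refine h.congr fun n => ?_
  rw [← Finset.sum_add_distrib, Finset.mul_sum]
  rw [Complex.ofReal_sum]
  refine Finset.sum_congr rfl fun j _ => ?_
  rw [Complex.ofReal_sub, fw_term (j + 1/3) s (by positivity), fw_term (j + 2/3) s (by positivity)]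
  have a1 : (1 / 3 + (s / π : ℝ) * Complex.I + j : ℂ) =
      ((j + 1/3 : ℝ) : ℂ) + (s / π : ℝ) * Complex.I := by push_cast; ring
  have a2 : (1 / 3 + (-s / π : ℝ) * Complex.I + j : ℂ) =
      ((j + 1/3 : ℝ) : ℂ) + (-s / π : ℝ) * Complex.I := by push_cast; ring
  have a3 : (j + 1 - (1 / 3 + (s / π : ℝ) * Complex.I) : ℂ) =
      ((j + 2/3 : ℝ) : ℂ) + (-s / π : ℝ) * Complex.I := by push_cast; ring
  have a4 : (j + 1 - (1 / 3 + (-s / π : ℝ) * Complex.I) : ℂ) =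
      ((j + 2/3 : ℝ) : ℂ) + (s / π : ℝ) * Complex.I := by push_cast; ring
  rw [a1, a2, a3, a4]
  ring

lemma fw_C (s : ℝ) :
    ∫ t in Set.Ioi (0 : ℝ), Real.cos (s * t) * (Real.sinh (π * t / 6) / Real.sinh (π * t / 2)) =
      √3 / (2 * Real.cosh (2 * s) + 1) := by
  have h := hasSum_integral_of_summable_integral_norm (fun n => (fw_F s n).1) (fw_norm s)
  simp only [(fw_F s _).2] at h
  have h2 := tendsto_nhds_unique h.tendsto_sum_nat (fw_sum s)
  rw [← h2]
  refine setIntegral_congr_fun measurableSet_Ioi fun t ht => ?_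
  exact (((fw_ker t ht).mul_left (Real.cos (s * t))).tsum_eq).symm

lemma fw_Cint (s : ℝ) :
    IntegrableOn (fun t : ℝ =>
      Real.cos (s * t) * (Real.sinh (π * t / 6) / Real.sinh (π * t / 2))) (Set.Ioi 0) := by
  refine Integrable.mono' (g := fun t => Real.exp (-(π/3) * t))
    (integrableOn_exp_mul_Ioi (by have := pi_pos; linarith) 0) ?_ ?_
  · apply Measurable.aestronglyMeasurable
    fun_prop
  · refine (ae_restrict_iff' measurableSet_Ioi).2 (Filter.Eventually.of_forall fun t ht => ?_)
    have ht : 0 < t := ht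
    have hu : 0 < π * t := by positivity
    have p1 : 0 < Real.sinh (π * t / 6) := Real.sinh_pos_iff.2 (by linarith)
    have p2 : 0 < Real.sinh (π * t / 2) := Real.sinh_pos_iff.2 (by linarith)
    rw [norm_mul, Real.norm_of_nonneg (div_pos p1 p2).le, Real.norm_eq_abs]
    refine (mul_le_of_le_one_left (div_pos p1 p2).le (Real.abs_cos_le_one _)).trans ?_
    rw [div_le_iff₀ p2, Real.sinh_eq, Real.sinh_eq, mul_div_assoc', mul_sub, ← Real.exp_add,
      ← Real.exp_add]
    have e1 : -(π/3) * t + π * t / 2 = π * t / 6 := by ring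
    have e2 : -(π/3) * t + -(π * t / 2) ≤ -(π * t / 6) := by linarith
    rw [e1]
    have := Real.exp_le_exp.2 e2
    linarith

theorem fourier_weight (x y : ℝ) (hx : |x| < Real.pi / 3) (hy : |y| < Real.pi / 3) :
    MeasureTheory.IntegrableOn
      (fun t : ℝ => Real.sin (x * t) * Real.sin (y * t) *
        Real.sinh (Real.pi * t / 6) / Real.sinh (Real.pi * t / 2)) (Set.Ioi 0) ∧
    (Real.sqrt 3 / 2) *
        (1 / (2 * Real.cosh (2 * (x - y)) + 1) - 1 / (2 * Real.cosh (2 * (x + y)) + 1)) =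
      ∫ t in Set.Ioi (0 : ℝ),
        Real.sin (x * t) * Real.sin (y * t) *
          Real.sinh (Real.pi * t / 6) / Real.sinh (Real.pi * t / 2) := by
  have e : (fun t : ℝ => Real.sin (x * t) * Real.sin (y * t) *
        Real.sinh (Real.pi * t / 6) / Real.sinh (Real.pi * t / 2)) = fun t : ℝ => (1 / 2) *
      (Real.cos ((x - y) * t) * (Real.sinh (π * t / 6) / Real.sinh (π * t / 2)) -
       Real.cos ((x + y) * t) * (Real.sinh (π * t / 6) / Real.sinh (π * t / 2))) := by
    ext t
    rw [sub_mul x y t, add_mul x y t, Real.cos_sub, Real.cos_add]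
    ring
  rw [e]
  refine ⟨((fw_Cint _).sub (fw_Cint _)).const_mul _, ?_⟩
  rw [integral_const_mul, integral_sub (fw_Cint _) (fw_Cint _), fw_C, fw_C]
  ring
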